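/- For every sequence σ = (σ_k)_{k≥0} with each σ_k ∈ {L, M, R}, the language L_σ is letter-2-balanced, i.e., ||w|_a − |w'|_a| ≤ 2 for each letter a ∈ {0,1} and all w, w' ∈ L_σ with |w| = |w'|. -/

import Mathlib

open List

/-- Number of occurrences of `v` as a factor of `w`, i.e. the number of
decompositions `w = p ++ v ++ s`. -/
def occ {A : Type*} [DecidableEq A] (v w : List A) : ℕ :=
  (List.range (w.length + 1)).countP (fun i => decide (v <+: w.drop i))

/-- Apply a substitution (given by its values on letters) to a word. -/
def applyS {A B : Type*} (σ : A → List B) (w : List A) : List B :=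
  (w.map σ).flatten

/-- The substitution `L : 0 ↦ 0, 1 ↦ 10` (with `0 = false`, `1 = true`). -/
def Lsub : Bool → List Bool
  | false => [false]
  | true => [true, false]

/-- The (Thue–Morse) substitution `M : 0 ↦ 01, 1 ↦ 10`. -/
def Msub : Bool → List Bool
  | false => [false, true]
  | true => [true, false]

/-- The substitution `R : 0 ↦ 01, 1 ↦ 1`. -/
def Rsub : Bool → List Bool
  | false => [false, true]
  | true => [true]

/-- For a sequence of substitutions `σ = (σ_k)`, the composition
`σ_{[0,n)} = σ_0 ∘ σ_1 ∘ ⋯ ∘ σ_{n-1}`, on letters. -/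
def seg0 (σ : ℕ → Bool → List Bool) : ℕ → Bool → List Bool
  | 0, a => [a]
  | n + 1, a => applyS (seg0 σ n) (σ n a)

/-- The language of the sequence `σ`: words that are factors of `σ_{[0,n)}(a)` for
some letter `a`, for infinitely many `n`. -/
def LangSeq (σ : ℕ → Bool → List Bool) : Set (List Bool) :=
  {w | {n : ℕ | ∃ a : Bool, w <:+: seg0 σ n a}.Infinite}

theorem occ_singleton {A : Type*} [DecidableEq A] (a : A) (w : List A) :
    occ [a] w = w.count a := by
  induction w with
  | nil => simp [occ]
  | cons b w ih =>
    rw [occ] at ih ⊢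
    rw [List.length_cons, List.range_succ_eq_map, List.countP_cons, List.countP_map,
      List.count_cons, ← ih]
    congr 1
    by_cases h : b = a
    · simp [h]
    · simp [h, Ne.symm h]

theorem applyS_append {A B : Type*} (τ : A → List B) (u v : List A) :
    applyS τ (u ++ v) = applyS τ u ++ applyS τ v := by
  simp [applyS]

theorem applyS_cons {A B : Type*} (τ : A → List B) (a : A) (w : List A) :
    applyS τ (a :: w) = τ a ++ applyS τ w := by
  simp [applyS]

theorem applyS_applyS {A B C : Type*} (τ : B → List C) (ρ : A → List B) (w : List A) :
    applyS τ (applyS ρ w) = applyS (fun a => applyS τ (ρ a)) w := by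
  induction w with
  | nil => rfl
  | cons a w ih => rw [applyS_cons, applyS_append, ih, applyS_cons]

theorem seg0_succ_shift (σ : ℕ → Bool → List Bool) (n : ℕ) (a : Bool) :
    seg0 σ (n + 1) a = applyS (σ 0) (seg0 (fun k => σ (k + 1)) n a) := by
  induction n generalizing a with
  | zero => simp [seg0, applyS, ← List.flatMap_def]
  | succ n ih =>
    rw [seg0, show seg0 σ (n + 1) = _ from funext ih, ← applyS_applyS]
    rfl

/-- The substitution sending `c` to `c` followed by the other letter and fixing the other letter;
it is `Lsub` for `c = true` and `Rsub` for `c = false`. -/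
def elementarySub (c b : Bool) : List Bool :=
  if b = c then [c, !c] else [!c]

theorem Lsub_eq : Lsub = elementarySub true := by
  funext b; cases b <;> rfl

theorem Rsub_eq : Rsub = elementarySub false := by
  funext b; cases b <;> rfl

theorem exists_prefix_of_prefix_elementarySub (c : Bool) (x w : List Bool)
    (h : w <+: applyS (elementarySub c) x) :
    ∃ u, u <+: x ∧ w.count c = u.count c ∧
      w.count (!c) ≤ u.length ∧
      u.length ≤ w.count (!c) + 1 := by
  induction x generalizing w with
  | nil =>
    obtain rfl : w = [] := by simpa [applyS] using h
    exact ⟨[], by simp⟩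
  | cons b x ih =>
    rw [applyS_cons] at h
    by_cases hb : b = c
    · subst hb
      rw [elementarySub, if_pos rfl, List.cons_append, List.cons_append, List.nil_append,
        List.prefix_cons_iff] at h
      obtain rfl | ⟨t, rfl, h⟩ := h
      · exact ⟨[], by simp⟩
      obtain rfl | ⟨t, rfl, ht⟩ := List.prefix_cons_iff.1 h
      · exact ⟨[b], by simp⟩
      obtain ⟨u, hu, h⟩ := ih t ht
      refine ⟨b :: u, List.cons_prefix_cons.2 ⟨rfl, hu⟩, ?_⟩
      simp only [List.count_cons]
      cases b <;> simp at h ⊢ <;> omega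
    · obtain rfl : b = !c := by cases b <;> cases c <;> simp_all
      rw [elementarySub, if_neg hb, List.cons_append, List.nil_append,
        List.prefix_cons_iff] at h
      obtain rfl | ⟨t, rfl, h⟩ := h
      · exact ⟨[], by simp⟩
      obtain ⟨u, hu, h⟩ := ih t h
      refine ⟨(!c) :: u, List.cons_prefix_cons.2 ⟨rfl, hu⟩, ?_⟩
      simp only [List.count_cons]
      cases c <;> simp at h ⊢ <;> omega

theorem exists_infix_of_infix_elementarySub (c : Bool) (x w : List Bool)
    (h : w <:+: applyS (elementarySub c) x) :
    ∃ u, u <:+: x ∧ w.count c = u.count c ∧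
      w.count (!c) ≤ u.length + 1 ∧
      u.length ≤ w.count (!c) + 1 := by
  induction x generalizing w with
  | nil =>
    obtain rfl : w = [] := by simpa [applyS] using h
    exact ⟨[], by simp⟩
  | cons b x ih =>
    have of_prefix (h : w <+: applyS (elementarySub c) (b :: x)) :
        ∃ u, u <:+: b :: x ∧ w.count c = u.count c ∧
          w.count (!c) ≤ u.length + 1 ∧
          u.length ≤ w.count (!c) + 1 := by
      obtain ⟨u, hu, h₁, h₂, h₃⟩ := exists_prefix_of_prefix_elementarySub c _ w h
      exact ⟨u, hu.isInfix, h₁, by omega, h₃⟩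
    have of_infix (h : w <:+: applyS (elementarySub c) x) :
        ∃ u, u <:+: b :: x ∧ w.count c = u.count c ∧
          w.count (!c) ≤ u.length + 1 ∧
          u.length ≤ w.count (!c) + 1 := by
      obtain ⟨u, hu, h⟩ := ih w h
      exact ⟨u, List.infix_cons hu, h⟩
    rw [applyS_cons] at h of_prefix
    by_cases hb : b = c
    · subst hb
      rw [elementarySub, if_pos rfl, List.cons_append, List.cons_append,
        List.nil_append] at h of_prefix
      obtain h | h := List.infix_cons_iff.1 h
      · exact of_prefix h
      obtain h | h := List.infix_cons_iff.1 h
      · obtain rfl | ⟨t, rfl, ht⟩ := List.prefix_cons_iff.1 h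
        · exact ⟨[], by simp⟩
        obtain ⟨u, hu, h⟩ := exists_prefix_of_prefix_elementarySub b _ t ht
        refine ⟨u, List.infix_cons hu.isInfix, ?_⟩
        simp only [List.count_cons]
        cases b <;> simp at h ⊢ <;> omega
      · exact of_infix h
    · rw [elementarySub, if_neg hb, List.cons_append, List.nil_append] at h of_prefix
      obtain h | h := List.infix_cons_iff.1 h
      · exact of_prefix h
      · exact of_infix h

theorem count_of_prefix_Msub (x w : List Bool) (h : w <+: applyS Msub x) (c : Bool) :
    w.count c ≤ w.count (!c) + 1 := by
  induction x generalizing w with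
  | nil =>
    obtain rfl : w = [] := by simpa [applyS] using h
    simp
  | cons b x ih =>
    obtain ⟨d, hd⟩ : ∃ d, Msub b = [d, !d] := by cases b <;> exact ⟨_, rfl⟩
    rw [applyS_cons, hd, List.cons_append, List.cons_append, List.nil_append,
      List.prefix_cons_iff] at h
    obtain rfl | ⟨t, rfl, h⟩ := h
    · simp
    obtain rfl | ⟨t, rfl, ht⟩ := List.prefix_cons_iff.1 h
    · cases c <;> cases d <;> simp
    have := ih t ht
    cases c <;> cases d <;> simp at this ⊢ <;> omega

theorem count_of_infix_Msub (x w : List Bool) (h : w <:+: applyS Msub x) (c : Bool) :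
    w.count c ≤ w.count (!c) + 2 := by
  induction x generalizing w with
  | nil =>
    obtain rfl : w = [] := by simpa [applyS] using h
    simp
  | cons b x ih =>
    have of_prefix (h : w <+: applyS Msub (b :: x)) : w.count c ≤ w.count (!c) + 2 :=
      (count_of_prefix_Msub _ w h c).trans (by omega)
    obtain ⟨d, hd⟩ : ∃ d, Msub b = [d, !d] := by cases b <;> exact ⟨_, rfl⟩
    rw [applyS_cons, hd, List.cons_append, List.cons_append, List.nil_append] at h of_prefix
    obtain h | h := List.infix_cons_iff.1 h
    · exact of_prefix h
    obtain h | h := List.infix_cons_iff.1 h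
    · obtain rfl | ⟨t, rfl, ht⟩ := List.prefix_cons_iff.1 h
      · simp
      have := count_of_prefix_Msub _ t ht c
      cases c <;> cases d <;> simp at this ⊢ <;> omega
    · exact ih w h

/-- No factor of a word in the family `F` has at least three more letters `!c` and at least three
fewer letters `c` than another such factor. -/
def AbelianTwoBalanced {ι : Type*} (F : ι → List Bool) : Prop :=
  ∀ (c : Bool) (i j : ι) (u v : List Bool), u <:+: F i → v <:+: F j →
    v.count (!c) + 3 ≤ u.count (!c) → ¬ u.count c + 3 ≤ v.count c

theorem AbelianTwoBalanced.elementarySub {ι : Type*} {F : ι → List Bool}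
    (hF : AbelianTwoBalanced F) (e : Bool) :
    AbelianTwoBalanced fun i => applyS (elementarySub e) (F i) := by
  intro c i j u v hu hv h₀ h₁
  obtain ⟨u', hu', hu⟩ := exists_infix_of_infix_elementarySub e _ u hu
  obtain ⟨v', hv', hv⟩ := exists_infix_of_infix_elementarySub e _ v hv
  have := u'.count_not_add_count c
  have := v'.count_not_add_count c
  obtain rfl | rfl : e = c ∨ e = !c := by cases e <;> cases c <;> simp
  · exact hF e i j u' v' hu' hv' (by omega) (by omega)
  · rw [Bool.not_not] at hu hv
    exact hF c i j u' v' hu' hv' (by omega) (by omega)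

theorem abelianTwoBalanced_Msub {ι : Type*} (F : ι → List Bool) :
    AbelianTwoBalanced fun i => applyS Msub (F i) := by
  intro c i j u v hu hv h₀ h₁
  have := count_of_infix_Msub _ u hu (!c)
  have := count_of_infix_Msub _ v hv c
  rw [Bool.not_not] at *
  omega

theorem abelianTwoBalanced_seg0 (n : ℕ) (σ : ℕ → Bool → List Bool)
    (hσ : ∀ k : ℕ, σ k = Lsub ∨ σ k = Msub ∨ σ k = Rsub) :
    AbelianTwoBalanced (seg0 σ n) := by
  induction n generalizing σ with
  | zero =>
    intro c i j u v hu hv h₀ h₁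
    have := hu.length_le
    have := List.count_le_length (a := !c) (l := u)
    simp only [seg0, List.length_singleton] at *
    omega
  | succ n ih =>
    rw [show seg0 σ (n + 1) = _ from funext (seg0_succ_shift σ n)]
    have := ih (fun k => σ (k + 1)) fun k => hσ (k + 1)
    obtain h | h | h := hσ 0 <;> rw [h]
    · exact Lsub_eq ▸ this.elementarySub true
    · exact abelianTwoBalanced_Msub _
    · exact Rsub_eq ▸ this.elementarySub false

theorem seg0_infix_seg0 (σ : ℕ → Bool → List Bool)
    (hσ : ∀ k : ℕ, σ k = Lsub ∨ σ k = Msub ∨ σ k = Rsub) (a : Bool) {m n : ℕ} (h : m ≤ n) :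
    seg0 σ m a <:+: seg0 σ n a := by
  induction n, h using Nat.le_induction with
  | base => exact List.infix_rfl
  | succ n _ ih =>
    refine ih.trans ?_
    have ha : a ∈ σ n a := by
      obtain h | h | h := hσ n <;> rw [h] <;> cases a <;> simp [Lsub, Msub, Rsub]
    exact List.infix_of_mem_flatten (List.mem_map_of_mem ha)

/-- for every sequence `σ` of substitutions from `{L, M, R}`, the
language `L_σ` is letter-2-balanced. -/
theorem LMR_letter_two_balanced (σ : ℕ → Bool → List Bool)
    (hσ : ∀ k : ℕ, σ k = Lsub ∨ σ k = Msub ∨ σ k = Rsub) :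
    ∀ a : Bool, ∀ w ∈ LangSeq σ, ∀ w' ∈ LangSeq σ, w.length = w'.length →
      |(occ [a] w : ℤ) - (occ [a] w' : ℤ)| ≤ 2 := by
  intro a w hw w' hw' hlen
  obtain ⟨m, b, hm⟩ := Set.Infinite.nonempty hw
  obtain ⟨n, b', hn⟩ := Set.Infinite.nonempty hw'
  have hm := hm.trans (seg0_infix_seg0 σ hσ b (le_max_left m n))
  have hn := hn.trans (seg0_infix_seg0 σ hσ b' (le_max_right m n))
  have bal := abelianTwoBalanced_seg0 (max m n) σ hσ a
  have h₁ := bal b b' w w' hm hn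
  have h₂ := bal b' b w' w hn hm
  have hw := List.count_not_add_count w a
  have hw' := List.count_not_add_count w' a
  rw [occ_singleton, occ_singleton, abs_le]
  omega
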